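/- arXiv:2507.21752 — 2 statements merged into one kernel-verified Lean document; each statement's English description precedes it below -/
import Mathlib

section
/- Let O be any set with {∃,⊔} ⊆ O ⊆ {¬,⊓,⊔,∀,∃}. No fitting algorithm for L(O) that, whenever some fitting L(O) concept exists, returns a fitting concept of minimal quantifier depth among all fitting L(O) concepts, is a sample-efficient PAC learning algorithm. -/
open scoped ENNReal

namespace ALCPaper

/-- ALC concepts; concept names and role names are natural numbers. -/
inductive ALC : Type
  | bot
  | top
  | atom (A : ℕ)
  | neg (c : ALC)
  | inter (c d : ALC)
  | union (c d : ALC)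
  | all (r : ℕ) (c : ALC)
  | ex (r : ℕ) (c : ALC)
  deriving DecidableEq

/-- An interpretation: a domain of natural numbers, extensions of concept names,
and extensions of role names. -/
structure Interp where
  dom : Set ℕ
  cI : ℕ → Set ℕ
  rI : ℕ → Set (ℕ × ℕ)

/-- Well-formedness of an interpretation: the domain is nonempty, concept name
extensions are subsets of the domain and role name extensions are binary relations
on the domain. -/
def Interp.WF (I : Interp) : Prop :=
  I.dom.Nonempty ∧ (∀ A, I.cI A ⊆ I.dom) ∧
    ∀ r, ∀ p ∈ I.rI r, p.1 ∈ I.dom ∧ p.2 ∈ I.dom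

/-- The extension `C^I` of a concept `C` in an interpretation `I`. -/
def ALC.sem : ALC → Interp → Set ℕ
  | .bot, _ => ∅
  | .top, I => I.dom
  | .atom A, I => I.cI A
  | .neg c, I => I.dom \ c.sem I
  | .inter c d, I => c.sem I ∩ d.sem I
  | .union c d, I => c.sem I ∪ d.sem I
  | .all r c, I => {d | d ∈ I.dom ∧ ∀ e, (d, e) ∈ I.rI r → e ∈ c.sem I}
  | .ex r c, I => {d | ∃ e, (d, e) ∈ I.rI r ∧ e ∈ c.sem I}

/-- The size of a concept: the number of nodes of its syntax tree. -/
def ALC.size : ALC → ℕ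
  | .bot => 1
  | .top => 1
  | .atom _ => 1
  | .neg c => c.size + 1
  | .inter c d => c.size + d.size + 1
  | .union c d => c.size + d.size + 1
  | .all _ c => c.size + 1
  | .ex _ c => c.size + 1

/-- The quantifier depth of a concept: the nesting depth of ∃/∀. -/
def ALC.qdepth : ALC → ℕ
  | .bot => 0
  | .top => 0
  | .atom _ => 0
  | .neg c => c.qdepth
  | .inter c d => max c.qdepth d.qdepth
  | .union c d => max c.qdepth d.qdepth
  | .all _ c => c.qdepth + 1
  | .ex _ c => c.qdepth + 1

/-- The concept names occurring in a concept. -/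
def ALC.conceptNames : ALC → Finset ℕ
  | .bot => ∅
  | .top => ∅
  | .atom A => {A}
  | .neg c => c.conceptNames
  | .inter c d => c.conceptNames ∪ d.conceptNames
  | .union c d => c.conceptNames ∪ d.conceptNames
  | .all _ c => c.conceptNames
  | .ex _ c => c.conceptNames

/-- The role names occurring in a concept. -/
def ALC.roleNames : ALC → Finset ℕ
  | .bot => ∅
  | .top => ∅
  | .atom _ => ∅
  | .neg c => c.roleNames
  | .inter c d => c.roleNames ∪ d.roleNames
  | .union c d => c.roleNames ∪ d.roleNames
  | .all r c => insert r c.roleNames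
  | .ex r c => insert r c.roleNames

/-- The five constructors ¬, ⊓, ⊔, ∀, ∃. -/
inductive Op : Type
  | neg | inter | union | all | ex
  deriving DecidableEq

/-- Membership in the fragment L(O): the concept is built from ⊤, ⊥ and concept
names using only constructors from O. -/
def ALC.InLang (O : Set Op) : ALC → Prop
  | .bot => True
  | .top => True
  | .atom _ => True
  | .neg c => Op.neg ∈ O ∧ c.InLang O
  | .inter c d => Op.inter ∈ O ∧ c.InLang O ∧ d.InLang O
  | .union c d => Op.union ∈ O ∧ c.InLang O ∧ d.InLang O
  | .all _ c => Op.all ∈ O ∧ c.InLang O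
  | .ex _ c => Op.ex ∈ O ∧ c.InLang O

/-- The dual of a constructor. -/
def Op.dual : Op → Op
  | .neg => .neg
  | .inter => .union
  | .union => .inter
  | .all => .ex
  | .ex => .all

/-- The dual concept C̄. -/
def ALC.dual : ALC → ALC
  | .bot => .top
  | .top => .bot
  | .atom A => .atom A
  | .neg c => .neg c.dual
  | .inter c d => .union c.dual d.dual
  | .union c d => .inter c.dual d.dual
  | .all r c => .ex r c.dual
  | .ex r c => .all r c.dual

open Classical in
/-- The interpretation Ī_Σ obtained by complementing the extensions of the concept
names in Σ (here `S` is the set of concept names of the signature Σ). -/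
noncomputable def Interp.dualWrt (I : Interp) (S : Set ℕ) : Interp where
  dom := I.dom
  cI := fun A => if A ∈ S then I.dom \ I.cI A else I.cI A
  rI := I.rI

/-- A pointed interpretation. -/
abbrev Ex : Type := Interp × ℕ

/-- A finite interpretation: finite domain and only finitely many concept and role
names with nonempty extension. -/
def Interp.FiniteI (I : Interp) : Prop :=
  I.dom.Finite ∧ {A | (I.cI A).Nonempty}.Finite ∧ {r | (I.rI r).Nonempty}.Finite

/-- An example: a finite (well-formed) interpretation with a distinguished domain
element. -/
def IsExample (e : Ex) : Prop := e.1.WF ∧ e.1.FiniteI ∧ e.2 ∈ e.1.dom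

/-- The dual example (Ī_Σ, a). -/
noncomputable def dualEx (S : Set ℕ) (e : Ex) : Ex := (e.1.dualWrt S, e.2)

/-- `C` fits the positive examples `P` and the negative examples `N`. -/
def Fits (C : ALC) (P N : Set Ex) : Prop :=
  (∀ e ∈ P, e.2 ∈ C.sem e.1) ∧ ∀ e ∈ N, e.2 ∉ C.sem e.1

/-- Subsumption C ⊑ D: `C^I ⊆ D^I` for every interpretation `I`. -/
def Subsume (C D : ALC) : Prop := ∀ I : Interp, I.WF → C.sem I ⊆ D.sem I

/-- Equivalence of concepts. -/
def CEquiv (C D : ALC) : Prop := Subsume C D ∧ Subsume D C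

/-- The concept names occurring in (the facts of) a set of examples. -/
def exCNames (E : Set Ex) : Set ℕ := {A | ∃ e ∈ E, (e.1.cI A).Nonempty}

/-- The role names occurring in (the facts of) a set of examples. -/
def exRNames (E : Set Ex) : Set ℕ := {r | ∃ e ∈ E, (e.1.rI r).Nonempty}

/-- Number of facts of an interpretation, viewed as a set of facts `A(d)`, `r(d,e)`. -/
noncomputable def Interp.numFacts (I : Interp) : ℕ :=
  {p : ℕ × ℕ | p.2 ∈ I.cI p.1}.ncard + {t : ℕ × ℕ × ℕ | (t.2.1, t.2.2) ∈ I.rI t.1}.ncard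

/-- The size of an example: number of facts plus one. -/
noncomputable def exSize (e : Ex) : ℕ := e.1.numFacts + 1

/-- Probability of a set of examples under a distribution. -/
noncomputable def probOf (D : PMF Ex) (S : Set Ex) : ℝ≥0∞ :=
  ∑' e : Ex, S.indicator (fun x => D x) e

/-- The error of a hypothesis `CH` with respect to a target `CT`:
the probability of the examples labeled differently by `CT` and `CH`. -/
noncomputable def errP (D : PMF Ex) (CT CH : ALC) : ℝ≥0∞ :=
  probOf D {e | Xor' (e.2 ∈ CT.sem e.1) (e.2 ∈ CH.sem e.1)}

/-- Probability that a tuple of `M` examples drawn independently from `D` lies in `T`. -/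
noncomputable def iidProb (D : PMF Ex) (M : ℕ) (T : Set (Fin M → Ex)) : ℝ≥0∞ :=
  ∑' f : Fin M → Ex, T.indicator (fun g => ∏ i, D (g i)) f

/-- `D` is a probability distribution over examples over the signature (Sc, Sr),
each of size at most `s`. -/
def DistOverSig (D : PMF Ex) (Sc Sr : Set ℕ) (s : ℕ) : Prop :=
  ∀ e : Ex, D e ≠ 0 → IsExample e ∧ exSize e ≤ s ∧
    (∀ A, (e.1.cI A).Nonempty → A ∈ Sc) ∧ ∀ r, (e.1.rI r).Nonempty → r ∈ Sr

/-- The positive examples of a drawn sample, labeled according to the target `CT`. -/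
def posOf {M : ℕ} (f : Fin M → Ex) (CT : ALC) : Set Ex :=
  {e | (∃ i, f i = e) ∧ e.2 ∈ CT.sem e.1}

/-- The negative examples of a drawn sample, labeled according to the target `CT`. -/
def negOf {M : ℕ} (f : Fin M → Ex) (CT : ALC) : Set Ex :=
  {e | (∃ i, f i = e) ∧ e.2 ∉ CT.sem e.1}

/-- A fitting algorithm for L(O): on finite sets of examples it returns an L(O)
concept fitting them whenever some L(O) concept fits. -/
def IsFittingAlg (O : Set Op) (Alg : Set Ex → Set Ex → ALC) : Prop :=
  ∀ P N : Set Ex, P.Finite → N.Finite → (∀ e ∈ P ∪ N, IsExample e) →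
    (∃ C : ALC, C.InLang O ∧ Fits C P N) →
    (Alg P N).InLang O ∧ Fits (Alg P N) P N

/-- `m` is bounded by a polynomial in its arguments. -/
def PolyBound (m : ℝ → ℝ → ℕ → ℕ → ℕ → ℕ) : Prop :=
  ∃ c d : ℕ, ∀ (x y : ℝ) (a b e : ℕ),
    m x y a b e ≤ c * (⌈|x|⌉₊ + ⌈|y|⌉₊ + a + b + e + 1) ^ d

/-- `Alg` is a sample-efficient PAC learning algorithm for L(O): there is a
polynomial sample bound m such that for all ε, δ ∈ (0,1), all signatures, all size
bounds s, n, all distributions over examples over the signature of size at most s,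
and all targets in L(O) over the signature of size at most n, with probability at
least 1 − δ over m(1/δ, 1/ε, |Σ|, s, n) i.i.d. labeled examples, the output is an
L(O) concept with error at most ε. -/
def SampleEfficientPAC (O : Set Op) (Alg : Set Ex → Set Ex → ALC) : Prop :=
  ∃ m : ℝ → ℝ → ℕ → ℕ → ℕ → ℕ, PolyBound m ∧
    ∀ ε δ : ℝ, 0 < ε → ε < 1 → 0 < δ → δ < 1 →
      ∀ Sc Sr : Set ℕ, Sc.Finite → Sr.Finite →
        ∀ s n : ℕ, ∀ D : PMF Ex, DistOverSig D Sc Sr s →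
          ∀ CT : ALC, CT.InLang O → (CT.conceptNames : Set ℕ) ⊆ Sc →
            (CT.roleNames : Set ℕ) ⊆ Sr → CT.size ≤ n →
            1 - ENNReal.ofReal δ ≤
              iidProb D (m (1 / δ) (1 / ε) (Sc.ncard + Sr.ncard) s n)
                {f | (Alg (posOf f CT) (negOf f CT)).InLang O ∧
                  errP D CT (Alg (posOf f CT) (negOf f CT)) ≤ ENNReal.ofReal ε}

/-- `Alg` always returns a most specific fitting whenever a fitting exists. -/
def ReturnsMostSpecific (O : Set Op) (Alg : Set Ex → Set Ex → ALC) : Prop :=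
  ∀ P N : Set Ex, P.Finite → N.Finite → (∀ e ∈ P ∪ N, IsExample e) →
    (∃ C : ALC, C.InLang O ∧ Fits C P N) →
    Fits (Alg P N) P N ∧
      ¬∃ D : ALC, D.InLang O ∧ Fits D P N ∧ Subsume D (Alg P N) ∧ ¬CEquiv D (Alg P N)

/-- `Alg` always returns a most general fitting whenever a fitting exists. -/
def ReturnsMostGeneral (O : Set Op) (Alg : Set Ex → Set Ex → ALC) : Prop :=
  ∀ P N : Set Ex, P.Finite → N.Finite → (∀ e ∈ P ∪ N, IsExample e) →
    (∃ C : ALC, C.InLang O ∧ Fits C P N) →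
    Fits (Alg P N) P N ∧
      ¬∃ D : ALC, D.InLang O ∧ Fits D P N ∧ Subsume (Alg P N) D ∧ ¬CEquiv (Alg P N) D

/-- `Alg` always returns a fitting of minimal quantifier depth whenever a fitting
exists. -/
def ReturnsMinQDepth (O : Set Op) (Alg : Set Ex → Set Ex → ALC) : Prop :=
  ∀ P N : Set Ex, P.Finite → N.Finite → (∀ e ∈ P ∪ N, IsExample e) →
    (∃ C : ALC, C.InLang O ∧ Fits C P N) →
    Fits (Alg P N) P N ∧
      ∀ D : ALC, D.InLang O → Fits D P N → (Alg P N).qdepth ≤ D.qdepth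

def bt (v i : ℕ) : ℕ := (v.testBit i).toNat

theorem bt_le (v i : ℕ) : bt v i ≤ 1 := by
  unfold bt; cases v.testBit i <;> simp

theorem bt_inj {v w i : ℕ} (h : bt v i = bt w i) : v.testBit i = w.testBit i := by
  unfold bt at h
  revert h
  cases v.testBit i <;> cases w.testBit i <;> simp

def wI (n v : ℕ) (b : Bool) : Interp where
  dom := {i | i ≤ n + 1}
  cI := fun A => {x | A = 0 ∧ x = n + 1 ∧ b = true}
  rI := fun r => {p | p.2 = p.1 + 1 ∧ p.1 ≤ n ∧ (r = 2 ∨ r = bt v p.1)}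

theorem wI_depth (n v : ℕ) (C : ALC) : ∀ k, k + C.qdepth ≤ n →
    (k ∈ C.sem (wI n v true) ↔ k ∈ C.sem (wI n v false)) := by
  induction C with
  | bot => intro k _; rfl
  | top => intro k _; rfl
  | atom A =>
    intro k hk
    simp only [ALC.qdepth] at hk
    simp only [ALC.sem, wI, Set.mem_setOf_eq]
    constructor
    · rintro ⟨_, h, _⟩; omega
    · rintro ⟨_, h, _⟩; omega
  | neg c ih =>
    intro k hk
    simp only [ALC.qdepth] at hk
    simp only [ALC.sem, Set.mem_diff, ih k hk]
    rfl
  | inter c d ihc ihd =>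
    intro k hk
    simp only [ALC.qdepth] at hk
    simp only [ALC.sem, Set.mem_inter_iff, ihc k (by omega), ihd k (by omega)]
  | union c d ihc ihd =>
    intro k hk
    simp only [ALC.qdepth] at hk
    simp only [ALC.sem, Set.mem_union, ihc k (by omega), ihd k (by omega)]
  | all r c ih =>
    intro k hk
    simp only [ALC.qdepth] at hk
    have := ih (k + 1) (by omega)
    simp only [ALC.sem, Set.mem_setOf_eq]
    constructor
    · rintro ⟨h1, h2⟩
      refine ⟨h1, fun e he => ?_⟩
      have h3 := h2 e he
      obtain ⟨h4, _⟩ := he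
      simp only at h4
      subst h4
      exact this.1 h3
    · rintro ⟨h1, h2⟩
      refine ⟨h1, fun e he => ?_⟩
      have h3 := h2 e he
      obtain ⟨h4, _⟩ := he
      simp only at h4
      subst h4
      exact this.2 h3
  | ex r c ih =>
    intro k hk
    simp only [ALC.qdepth] at hk
    have := ih (k + 1) (by omega)
    simp only [ALC.sem, Set.mem_setOf_eq]
    constructor
    · rintro ⟨e, he, h3⟩
      refine ⟨e, he, ?_⟩
      obtain ⟨h4, _⟩ := he
      simp only at h4
      subst h4
      exact this.1 h3
    · rintro ⟨e, he, h3⟩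
      refine ⟨e, he, ?_⟩
      obtain ⟨h4, _⟩ := he
      simp only at h4
      subst h4
      exact this.2 h3

def tgt : ℕ → ALC
  | 0 => .atom 0
  | j + 1 => .ex 2 (tgt j)

theorem tgt_sem (n v : ℕ) (b : Bool) : ∀ j k, k + j = n + 1 →
    (k ∈ (tgt j).sem (wI n v b) ↔ b = true) := by
  intro j
  induction j with
  | zero =>
    intro k hk
    have : k = n + 1 := by omega
    simp [tgt, ALC.sem, wI, this]
  | succ j ih =>
    intro k hk
    have := ih (k + 1) (by omega)
    rw [← this]
    simp only [tgt, ALC.sem, Set.mem_setOf_eq]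
    constructor
    · rintro ⟨e, ⟨h4, _⟩, h⟩
      simp only at h4
      subst h4
      exact h
    · intro h
      exact ⟨k + 1, ⟨rfl, by simp only; omega, Or.inl rfl⟩, h⟩

theorem tgt_lang (O : Set Op) (h : Op.ex ∈ O) (j : ℕ) : (tgt j).InLang O := by
  induction j with
  | zero => trivial
  | succ j ih => exact ⟨h, ih⟩

theorem tgt_size (j : ℕ) : (tgt j).size = j + 1 := by
  induction j with
  | zero => rfl
  | succ j ih => simp [tgt, ALC.size, ih]

theorem tgt_cn (j : ℕ) : (tgt j).conceptNames = {0} := by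
  induction j with
  | zero => rfl
  | succ j ih => simp [tgt, ALC.conceptNames, ih]

theorem tgt_rn (j : ℕ) : (tgt j).roleNames ⊆ {2} := by
  induction j with
  | zero => simp [tgt, ALC.roleNames]
  | succ j ih =>
    simp only [tgt, ALC.roleNames]
    exact Finset.insert_subset (by simp) ih

def wc (v : ℕ) : ℕ → ℕ → ALC
  | _, 0 => .top
  | k, j + 1 => .ex (bt v k) (wc v (k + 1) j)

theorem wc_sem (n v w : ℕ) (b : Bool) : ∀ j k, k + j ≤ n + 1 →
    (k ∈ (wc v k j).sem (wI n w b) ↔ ∀ i, k ≤ i → i < k + j → bt v i = bt w i) := by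
  intro j
  induction j with
  | zero =>
    intro k hk
    simp only [wc, ALC.sem, wI, Set.mem_setOf_eq]
    constructor
    · intro _ i h1 h2; omega
    · intro _; omega
  | succ j ih =>
    intro k hk
    have := ih (k + 1) (by omega)
    simp only [wc, ALC.sem, Set.mem_setOf_eq]
    constructor
    · rintro ⟨e, ⟨h4, h5, h6⟩, h⟩ i h1 h2
      simp only at h4 h5 h6
      subst h4
      rcases Nat.eq_or_lt_of_le h1 with h7 | h7
      · subst h7
        rcases h6 with h6 | h6
        · have := bt_le v k; omega
        · exact h6
      · exact this.1 h i h7 (by omega)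
    · intro h
      refine ⟨k + 1, ⟨rfl, by simp only; omega, Or.inr (h k le_rfl (by omega))⟩, ?_⟩
      exact this.2 fun i h1 h2 => h i (by omega) (by omega)

theorem wc_lang (O : Set Op) (h : Op.ex ∈ O) (v j : ℕ) : ∀ k, (wc v k j).InLang O := by
  induction j with
  | zero => intro k; trivial
  | succ j ih => intro k; exact ⟨h, ih _⟩

theorem wc_depth (v j : ℕ) : ∀ k, (wc v k j).qdepth = j := by
  induction j with
  | zero => intro k; rfl
  | succ j ih => intro k; simp [wc, ALC.qdepth, ih]

theorem wc_iff (n v w : ℕ) (b : Bool) (hv : v < 2 ^ n) (hw : w < 2 ^ n) :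
    0 ∈ (wc v 0 n).sem (wI n w b) ↔ v = w := by
  rw [wc_sem n v w b n 0 (by omega)]
  constructor
  · intro h
    apply Nat.eq_of_testBit_eq
    intro i
    by_cases hi : i < n
    · exact bt_inj (h i (by omega) (by omega))
    · have h2 : 2 ^ n ≤ 2 ^ i := Nat.pow_le_pow_right (by norm_num) (by omega)
      rw [Nat.testBit_lt_two_pow (by omega), Nat.testBit_lt_two_pow (by omega)]
  · rintro rfl i _ _; rfl

def dj (n : ℕ) : List ℕ → ALC
  | [] => .bot
  | v :: l => .union (wc v 0 n) (dj n l)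

theorem dj_lang (O : Set Op) (h : Op.ex ∈ O) (hu : Op.union ∈ O) (n : ℕ) (l : List ℕ) :
    (dj n l).InLang O := by
  induction l with
  | nil => trivial
  | cons v l ih => exact ⟨hu, wc_lang O h v n 0, ih⟩

theorem dj_depth (n : ℕ) (l : List ℕ) : (dj n l).qdepth ≤ n := by
  induction l with
  | nil => simp [dj, ALC.qdepth]
  | cons v l ih => simp [dj, ALC.qdepth, wc_depth, ih]

theorem dj_sem (n w : ℕ) (b : Bool) (hw : w < 2 ^ n) (l : List ℕ) (hl : ∀ v ∈ l, v < 2 ^ n) :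
    0 ∈ (dj n l).sem (wI n w b) ↔ w ∈ l := by
  induction l with
  | nil => simp [dj, ALC.sem]
  | cons v l ih =>
    have h1 := ih fun u hu => hl u (List.mem_cons_of_mem _ hu)
    have h2 := wc_iff n v w b (hl v List.mem_cons_self) hw
    simp only [dj, ALC.sem, Set.mem_union, h1, h2, List.mem_cons, eq_comm]

theorem wI_isEx (n v : ℕ) (b : Bool) : IsExample (wI n v b, 0) := by
  refine ⟨⟨⟨0, ?_⟩, ?_, ?_⟩, ⟨?_, ?_, ?_⟩, ?_⟩
  · simp [wI]
  · rintro A x ⟨_, h, _⟩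
    simp only [wI, Set.mem_setOf_eq]; omega
  · rintro r p ⟨h1, h2, _⟩
    simp only [wI, Set.mem_setOf_eq]; omega
  · exact Set.finite_Iic (n + 1)
  · apply (Set.finite_singleton 0).subset
    rintro A ⟨x, h, _⟩
    exact h
  · apply (Set.finite_Iic 2).subset
    rintro r ⟨p, _, _, h⟩
    have := bt_le v p.1
    simp only [Set.mem_Iic]; omega
  · simp [wI]

theorem wI_size (n v : ℕ) (b : Bool) : exSize (wI n v b, 0) ≤ 3 * n + 5 := by
  have h1 : {p : ℕ × ℕ | p.2 ∈ (wI n v b).cI p.1}.ncard ≤ 1 := by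
    rw [← Set.ncard_singleton ((0, n + 1) : ℕ × ℕ)]
    apply Set.ncard_le_ncard
    · rintro ⟨A, x⟩ ⟨h1, h2, _⟩
      simp only at h1 h2
      simp [h1, h2]
    · exact Set.finite_singleton _
  have h2 : {t : ℕ × ℕ × ℕ | (t.2.1, t.2.2) ∈ (wI n v b).rI t.1}.ncard ≤ 3 * (n + 1) := by
    let F : Finset (ℕ × ℕ × ℕ) :=
      (Finset.range 3 ×ˢ Finset.range (n + 1)).image fun p => (p.1, p.2, p.2 + 1)
    have hF : F.card ≤ 3 * (n + 1) := by
      refine Finset.card_image_le.trans ?_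
      simp
    refine le_trans ?_ hF
    rw [← Set.ncard_coe_finset]
    apply Set.ncard_le_ncard
    · rintro ⟨r, x, y⟩ ⟨h1, h2, h3⟩
      simp only at h1 h2 h3
      have := bt_le v x
      simp only [F, Finset.coe_image, Set.mem_image, Finset.mem_coe, Finset.mem_product,
        Finset.mem_range]
      exact ⟨(r, x), ⟨by simp only; omega, by simp only; omega⟩, by simp [h1]⟩
    · exact F.finite_toSet
  simp only [exSize, Interp.numFacts]
  omega

abbrev X (n : ℕ) : Type := Fin (2 ^ n) × Bool

def eX (n : ℕ) (x : X n) : Ex := (wI n x.1 x.2, 0)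

theorem eX_tgt (n : ℕ) (x : X n) : (eX n x).2 ∈ (tgt (n + 1)).sem (eX n x).1 ↔ x.2 = true :=
  tgt_sem n x.1 x.2 (n + 1) 0 (by omega)

theorem eX_inj (n : ℕ) : Function.Injective (eX n) := by
  rintro x y h
  have h2 : x.2 = y.2 := by
    have h3 := eX_tgt n x
    rw [h, eX_tgt n y] at h3
    exact (Bool.eq_iff_iff.2 h3).symm
  have h1 : (x.1 : ℕ) = y.1 := by
    have h3 := wc_iff n x.1 x.1 x.2 x.1.2 x.1.2
    have h4 : wI n x.1 x.2 = wI n y.1 y.2 := congrArg Prod.fst h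
    rw [h4, wc_iff n x.1 y.1 y.2 x.1.2 y.1.2] at h3
    exact h3.2 rfl
  exact Prod.ext (Fin.ext h1) h2

noncomputable def dD (n : ℕ) : PMF Ex := (PMF.uniformOfFintype (X n)).map (eX n)

theorem dD_apply (n : ℕ) (x : X n) : dD n (eX n x) = ((2 ^ (n + 1) : ℕ) : ℝ≥0∞)⁻¹ := by
  rw [dD, PMF.map_apply, tsum_eq_single x]
  · simp [pow_succ]
  · intro y hy
    rw [if_neg]
    intro h
    exact hy (eX_inj n h).symm

theorem dD_supp (n : ℕ) (y : Ex) (h : dD n y ≠ 0) : ∃ x, eX n x = y := by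
  have : y ∈ (dD n).support := h
  rw [dD, PMF.support_map] at this
  obtain ⟨x, _, hx⟩ := this
  exact ⟨x, hx⟩

theorem dD_dist (n : ℕ) : DistOverSig (dD n) {0} {0, 1, 2} (3 * n + 5) := by
  intro y hy
  obtain ⟨x, rfl⟩ := dD_supp n y hy
  refine ⟨wI_isEx _ _ _, wI_size _ _ _, ?_, ?_⟩
  · rintro A ⟨z, h, _⟩
    exact h
  · rintro r ⟨p, _, _, h⟩
    have := bt_le x.1 p.1
    simp only [Set.mem_insert_iff, Set.mem_singleton_iff]
    omega

theorem err_big (n : ℕ) (C : ALC) (hC : C.qdepth ≤ n) :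
    (2 : ℝ≥0∞)⁻¹ ≤ errP (dD n) (tgt (n + 1)) C := by
  classical
  have hw : ∀ w : Fin (2 ^ n), ∃ b : Bool, Xor' ((eX n (w, b)).2 ∈ (tgt (n + 1)).sem (eX n (w, b)).1)
      ((eX n (w, b)).2 ∈ C.sem (eX n (w, b)).1) := by
    intro w
    have h := wI_depth n w C 0 (by omega)
    by_cases hc : 0 ∈ C.sem (wI n w false)
    · refine ⟨false, Or.inr ⟨hc, ?_⟩⟩
      rw [eX_tgt]; simp
    · refine ⟨true, Or.inl ⟨?_, ?_⟩⟩
      · rw [eX_tgt]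
      · exact fun h2 => hc (h.1 h2)
  choose b hb using hw
  have hinj : Function.Injective fun w : Fin (2 ^ n) => eX n (w, b w) := by
    intro w w' h
    exact congrArg Prod.fst (eX_inj n h)
  unfold errP probOf
  refine le_trans ?_ (ENNReal.tsum_comp_le_tsum_of_injective hinj _)
  rw [tsum_fintype]
  have : ∀ w : Fin (2 ^ n), Set.indicator {e : Ex | Xor' (e.2 ∈ (tgt (n + 1)).sem e.1)
      (e.2 ∈ C.sem e.1)} (fun x => dD n x) (eX n (w, b w)) = ((2 ^ (n + 1) : ℕ) : ℝ≥0∞)⁻¹ := by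
    intro w
    have hmem : eX n (w, b w) ∈ {e : Ex | Xor' (e.2 ∈ (tgt (n + 1)).sem e.1)
      (e.2 ∈ C.sem e.1)} := hb w
    rw [Set.indicator_of_mem hmem, dD_apply]
  rw [Finset.sum_congr rfl fun w _ => this w]
  simp only [Finset.sum_const, Finset.card_univ, Fintype.card_fin, nsmul_eq_mul]
  rw [pow_succ]
  push_cast
  rw [ENNReal.mul_inv (by simp) (by simp), ← mul_assoc, ENNReal.mul_inv_cancel (by simp) (by simp),
    one_mul]

def Coll {n M : ℕ} (g : Fin M → X n) : Prop :=
  ∃ i j, i ≠ j ∧ g j = ((g i).1, !(g i).2)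

open Classical in
theorem coll_card (n M : ℕ) :
    2 ^ (n + 1) * (Finset.univ.filter fun g : Fin M → X n => Coll g).card
      ≤ M ^ 2 * (2 ^ (n + 1)) ^ M := by
  have hX : Fintype.card (X n) = 2 ^ (n + 1) := by simp [pow_succ]
  have h1 : ∀ p : Fin M × Fin M, 2 ^ (n + 1) * (Finset.univ.filter fun g : Fin M → X n =>
      p.1 ≠ p.2 ∧ g p.2 = ((g p.1).1, !(g p.1).2)).card ≤ (2 ^ (n + 1)) ^ M := by
    rintro ⟨i, j⟩
    have hc : (Finset.univ : Finset (Fin M → X n)).card = (2 ^ (n + 1)) ^ M := by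
      rw [Finset.card_univ, Fintype.card_fun, hX, Fintype.card_fin]
    rw [← hc, ← hX, ← Finset.card_univ, ← Finset.card_product]
    apply Finset.card_le_card_of_injOn (fun q => Function.update q.2 j q.1)
    · intro _ _; simp
    · rintro ⟨x, g⟩ h ⟨x', g'⟩ h' heq
      simp only [Finset.coe_product, Finset.coe_univ, Finset.coe_filter, Finset.mem_univ, true_and,
        Set.mem_prod, Set.mem_univ, Set.mem_setOf_eq] at h h'
      obtain ⟨hij, hg⟩ := h
      obtain ⟨_, hg'⟩ := h'
      simp only at heq
      have e1 : x = x' := by simpa using congrFun heq j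
      have e2 : ∀ k, k ≠ j → g k = g' k := by
        intro k hk
        simpa [hk] using congrFun heq k
      have e3 : g = g' := by
        funext k
        by_cases hk : k = j
        · subst hk; rw [hg, hg', e2 i hij]
        · exact e2 k hk
      rw [e1, e3]
  have h2 : (Finset.univ.filter fun g : Fin M → X n => Coll g) ⊆
      (Finset.univ : Finset (Fin M × Fin M)).biUnion fun p => Finset.univ.filter fun g : Fin M → X n =>
      p.1 ≠ p.2 ∧ g p.2 = ((g p.1).1, !(g p.1).2) := by
    intro g hg
    obtain ⟨i, j, h⟩ := (Finset.mem_filter.1 hg).2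
    simp only [Finset.mem_biUnion, Finset.mem_filter, Finset.mem_univ, true_and]
    exact ⟨(i, j), h⟩
  calc _ ≤ 2 ^ (n + 1) * ∑ p : Fin M × Fin M, (Finset.univ.filter fun g : Fin M → X n =>
      p.1 ≠ p.2 ∧ g p.2 = ((g p.1).1, !(g p.1).2)).card :=
        Nat.mul_le_mul_left _ ((Finset.card_le_card h2).trans Finset.card_biUnion_le)
    _ ≤ ∑ p : Fin M × Fin M, (2 ^ (n + 1)) ^ M := by
        rw [Finset.mul_sum]
        exact Finset.sum_le_sum fun p _ => h1 p
    _ = _ := by simp [sq]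

theorem iid_le (n M : ℕ) (T : Set (Fin M → Ex))
    (hT : ∀ g : Fin M → X n, (fun i => eX n (g i)) ∈ T → Coll g) :
    iidProb (dD n) M T * ((2 ^ (n + 1) : ℕ) : ℝ≥0∞) ≤ (M : ℝ≥0∞) ^ 2 := by
  classical
  set K : ℕ := 2 ^ (n + 1) with hK
  have hK0 : (K : ℝ≥0∞) ≠ 0 := by simp [hK]
  have hKt : (K : ℝ≥0∞) ≠ ⊤ := by simp [hK]
  have hinj : Function.Injective fun (g : Fin M → X n) (i : Fin M) => eX n (g i) := by
    intro g g' h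
    funext i
    exact eX_inj n (congrFun h i)
  have h1 : iidProb (dD n) M T = ∑' g : Fin M → X n,
      T.indicator (fun g => ∏ i, dD n (g i)) fun i => eX n (g i) := by
    unfold iidProb
    symm
    apply hinj.tsum_eq
    intro f hf
    have hf1 : ∏ i, dD n (f i) ≠ 0 := by
      intro h0
      apply hf
      by_cases hm : f ∈ T
      · rw [Set.indicator_of_mem hm, h0]
      · rw [Set.indicator_of_notMem hm]
    rw [Finset.prod_ne_zero_iff] at hf1
    choose g hg using fun i => dD_supp n (f i) (hf1 i (Finset.mem_univ i))
    exact ⟨g, funext hg⟩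
  have h2 : iidProb (dD n) M T ≤
      ((Finset.univ.filter fun g : Fin M → X n => Coll g).card : ℝ≥0∞) * ((K : ℝ≥0∞)⁻¹) ^ M := by
    rw [h1, tsum_fintype]
    rw [← nsmul_eq_mul, ← Finset.sum_const, Finset.sum_filter]
    apply Finset.sum_le_sum
    intro g _
    by_cases hm : (fun i => eX n (g i)) ∈ T
    · rw [Set.indicator_of_mem hm, if_pos (hT g hm)]
      simp [dD_apply, hK]
    · rw [Set.indicator_of_notMem hm]
      exact zero_le
  have h3 : (K : ℝ≥0∞) * ((Finset.univ.filter fun g : Fin M → X n => Coll g).card : ℝ≥0∞)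
      ≤ (M : ℝ≥0∞) ^ 2 * (K : ℝ≥0∞) ^ M := by
    exact_mod_cast coll_card n M
  calc _ ≤ ((Finset.univ.filter fun g : Fin M → X n => Coll g).card : ℝ≥0∞) * ((K : ℝ≥0∞)⁻¹) ^ M * K :=
        mul_le_mul_left h2 _
    _ = ((K : ℝ≥0∞) * ((Finset.univ.filter fun g : Fin M → X n => Coll g).card : ℝ≥0∞)) *
        ((K : ℝ≥0∞)⁻¹) ^ M := by ring
    _ ≤ ((M : ℝ≥0∞) ^ 2 * (K : ℝ≥0∞) ^ M) * ((K : ℝ≥0∞)⁻¹) ^ M := mul_le_mul_left h3 _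
    _ = _ := by
      rw [mul_assoc, ← mul_pow, ENNReal.mul_inv_cancel hK0 hKt, one_pow, mul_one]

theorem growth (c d : ℕ) : ∃ n : ℕ, 2 * (c * (4 * n + 20) ^ d) ^ 2 < 2 ^ (n + 1) := by
  have h := tendsto_pow_const_div_const_pow_of_one_lt (2 * d) (r := (2 : ℝ)) (by norm_num)
  have hpos : (0 : ℝ) < 1 / ((c : ℝ) ^ 2 * 24 ^ (2 * d) + 1) := by positivity
  obtain ⟨n, hn, h1⟩ := ((h.eventually (gt_mem_nhds hpos)).and (Filter.eventually_ge_atTop 1)).exists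
  refine ⟨n, ?_⟩
  rw [div_lt_div_iff₀ (by positivity) (by positivity)] at hn
  have h2 : n ^ (2 * d) * (c ^ 2 * 24 ^ (2 * d) + 1) < 2 ^ n := by
    have : (n : ℝ) ^ (2 * d) * ((c : ℝ) ^ 2 * 24 ^ (2 * d) + 1) < 2 ^ n := by linarith
    exact_mod_cast this
  have h3 : (4 * n + 20) ^ (2 * d) ≤ (24 * n) ^ (2 * d) := Nat.pow_le_pow_left (by omega) _
  calc 2 * (c * (4 * n + 20) ^ d) ^ 2 = 2 * (c ^ 2 * (4 * n + 20) ^ (2 * d)) := by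
        rw [mul_pow, ← pow_mul, mul_comm d 2]
    _ ≤ 2 * (c ^ 2 * (24 * n) ^ (2 * d)) := by gcongr
    _ = 2 * (n ^ (2 * d) * (c ^ 2 * 24 ^ (2 * d))) := by rw [mul_pow]; ring
    _ ≤ 2 * (n ^ (2 * d) * (c ^ 2 * 24 ^ (2 * d) + 1)) := by gcongr; omega
    _ < 2 * 2 ^ n := by omega
    _ = 2 ^ (n + 1) := by rw [pow_succ]; ring

theorem alg_depth (O : Set Op) (hO : ({Op.ex, Op.union} : Set Op) ⊆ O)
    (Alg : Set Ex → Set Ex → ALC) (hmin : ReturnsMinQDepth O Alg) (n M : ℕ)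
    (g : Fin M → X n) (hg : ¬ Coll g) :
    (Alg (posOf (fun i => eX n (g i)) (tgt (n + 1)))
      (negOf (fun i => eX n (g i)) (tgt (n + 1)))).qdepth ≤ n := by
  classical
  have hex : Op.ex ∈ O := hO (by simp)
  have hun : Op.union ∈ O := hO (by simp)
  have hfin : (Set.range fun i => eX n (g i)).Finite := Set.finite_range _
  let F : Finset ℕ := (Finset.univ.filter fun i : Fin M => (g i).2 = true).image
    fun i => ((g i).1 : ℕ)
  have hF : ∀ v ∈ F.toList, v < 2 ^ n := by
    intro v hv
    simp only [F, Finset.mem_toList, Finset.mem_image] at hv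
    obtain ⟨i, _, rfl⟩ := hv
    exact (g i).1.2
  have hl := dj_lang O hex hun n F.toList
  have hfit : Fits (dj n F.toList) (posOf (fun i => eX n (g i)) (tgt (n + 1)))
      (negOf (fun i => eX n (g i)) (tgt (n + 1))) := by
    constructor
    · rintro _ ⟨⟨i, rfl⟩, hi⟩
      rw [eX_tgt] at hi
      refine (dj_sem n (g i).1 (g i).2 (g i).1.2 _ hF).2 ?_
      simp only [F, Finset.mem_toList, Finset.mem_image, Finset.mem_filter, Finset.mem_univ,
        true_and]
      exact ⟨i, hi, rfl⟩
    · rintro _ ⟨⟨j, rfl⟩, hj⟩ hm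
      rw [eX_tgt] at hj
      have := (dj_sem n (g j).1 (g j).2 (g j).1.2 _ hF).1 hm
      simp only [F, Finset.mem_toList, Finset.mem_image, Finset.mem_filter, Finset.mem_univ,
        true_and] at this
      obtain ⟨i, hi, hij⟩ := this
      refine hg ⟨i, j, ?_, ?_⟩
      · rintro rfl; exact hj hi
      · refine Prod.ext (Fin.ext hij.symm) ?_
        simp only [hi]
        simpa using hj
  refine ((hmin _ _ ?_ ?_ ?_ ⟨_, hl, hfit⟩).2 _ hl hfit).trans (dj_depth n _)
  · exact hfin.subset fun e he => he.1
  · exact hfin.subset fun e he => he.1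
  · rintro _ (⟨⟨i, rfl⟩, _⟩ | ⟨⟨i, rfl⟩, _⟩)
    · exact wI_isEx _ _ _
    · exact wI_isEx _ _ _


/-- For {∃,⊔} ⊆ O, no fitting algorithm for L(O) that always returns
a fitting concept of minimal quantifier depth (whenever some fitting exists) is a
sample-efficient PAC learning algorithm. -/
theorem statement10 (O : Set Op) (hO : ({Op.ex, Op.union} : Set Op) ⊆ O)
    (Alg : Set Ex → Set Ex → ALC) (hAlg : IsFittingAlg O Alg)
    (hmin : ReturnsMinQDepth O Alg) :
    ¬SampleEfficientPAC O Alg := by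
  rintro ⟨m, ⟨c, d, hm⟩, H⟩
  obtain ⟨n, hn⟩ := growth c d
  have hex : Op.ex ∈ O := hO (by simp)
  have h1 := H (1 / 4) (1 / 4) (by norm_num) (by norm_num) (by norm_num) (by norm_num)
    {0} {0, 1, 2} (Set.toFinite _) (Set.toFinite _) (3 * n + 5) (n + 2) (dD n) (dD_dist n)
    (tgt (n + 1)) (tgt_lang O hex _) (by rw [tgt_cn]; simp)
    (by
      intro r hr
      have := tgt_rn _ hr
      simp only [Finset.mem_singleton] at this
      simp [this]) (by rw [tgt_size])
  set M := m (1 / (1 / 4)) (1 / (1 / 4)) (({0} : Set ℕ).ncard + ({0, 1, 2} : Set ℕ).ncard)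
    (3 * n + 5) (n + 2) with hMdef
  have hM : M ≤ c * (4 * n + 20) ^ d := by
    refine (hm _ _ _ _ _).trans ?_
    have e1 : ⌈|(1 / (1 / 4) : ℝ)|⌉₊ = 4 := by
      have : |(1 / (1 / 4) : ℝ)| = ((4 : ℕ) : ℝ) := by norm_num
      rw [this, Nat.ceil_natCast]
    have e2 : ({0, 1, 2} : Set ℕ).ncard = 3 := by
      have : ({0, 1, 2} : Set ℕ) = (({0, 1, 2} : Finset ℕ) : Set ℕ) := by simp
      rw [this, Set.ncard_coe_finset]; rfl
    rw [e1, e2, Set.ncard_singleton]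
    apply Nat.mul_le_mul_left
    apply Nat.pow_le_pow_left
    omega
  have h2 := iid_le n M _ (fun g (hg : (fun i => eX n (g i)) ∈
      {f : Fin M → Ex | (Alg (posOf f (tgt (n + 1))) (negOf f (tgt (n + 1)))).InLang O ∧
        errP (dD n) (tgt (n + 1)) (Alg (posOf f (tgt (n + 1))) (negOf f (tgt (n + 1))))
          ≤ ENNReal.ofReal (1 / 4)}) => by
    by_contra hc
    have h3 := err_big n _ (alg_depth O hO Alg hmin n M g hc)
    have h4 := h3.trans hg.2
    have h5 : (2 : ℝ≥0∞)⁻¹ = ENNReal.ofReal (1 / 2) := by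
      rw [one_div, ENNReal.ofReal_inv_of_pos (by norm_num)]; simp
    rw [h5, ENNReal.ofReal_le_ofReal_iff (by norm_num)] at h4
    norm_num at h4)
  have h6 : (1 : ℝ≥0∞) - ENNReal.ofReal (1 / 4) = ENNReal.ofReal (3 / 4) := by
    rw [← ENNReal.ofReal_one, ← ENNReal.ofReal_sub _ (by norm_num)]; norm_num
  rw [h6] at h1
  have h7 := (mul_le_mul_left h1 ((2 ^ (n + 1) : ℕ) : ℝ≥0∞)).trans h2
  have h8 : (3 / 4 : ℝ) * ((2 ^ (n + 1) : ℕ) : ℝ) ≤ (M : ℝ) ^ 2 := by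
    rw [← ENNReal.ofReal_le_ofReal_iff (by positivity), ENNReal.ofReal_mul (by norm_num),
      ENNReal.ofReal_pow (by positivity), ENNReal.ofReal_natCast, ENNReal.ofReal_natCast]
    exact h7
  have h9 : 2 * M ^ 2 < 2 ^ (n + 1) := by
    refine lt_of_le_of_lt ?_ hn
    gcongr
  have h10 : (2 : ℝ) * (M : ℝ) ^ 2 < ((2 ^ (n + 1) : ℕ) : ℝ) := by exact_mod_cast h9
  have h11 : (0 : ℝ) ≤ (M : ℝ) ^ 2 := by positivity
  linarith

end ALCPaper
end

section
/- Let C and D be L({∃,⊔}) concepts in which neither ⊤ nor ⊥ occurs (so every leaf of each syntax tree is a concept name). Then D ⊑ C if and only if every path of D is a path of C. -/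
open scoped ENNReal

namespace ALCPaper

/-- Neither ⊤ nor ⊥ occurs: every leaf of the syntax tree is a concept name. -/
def ALC.noConst : ALC → Prop
  | .bot => False
  | .top => False
  | .atom _ => True
  | .neg c => c.noConst
  | .inter c d => c.noConst ∧ d.noConst
  | .union c d => c.noConst ∧ d.noConst
  | .all _ c => c.noConst
  | .ex _ c => c.noConst

/-- The paths of an L({∃,⊔}) concept: words `r₁⋯r_ℓ A` obtained by descending from
the root to a leaf, recording the role names of ∃-nodes, skipping ⊔-nodes, and
finally recording the concept name at the leaf. -/
def ALC.paths : ALC → Set (List ℕ × ℕ)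
  | .atom A => {([], A)}
  | .union c d => c.paths ∪ d.paths
  | .ex r c => {p | ∃ q ∈ c.paths, p = (r :: q.1, q.2)}
  | _ => ∅

/-- Semantics of a path. -/
def psem (I : Interp) : List ℕ → ℕ → ℕ → Prop
  | [], A, d => d ∈ I.cI A
  | r :: u, A, d => ∃ e, (d, e) ∈ I.rI r ∧ psem I u A e

theorem sem_iff (I : Interp) (C : ALC) (hC : C.InLang {Op.ex, Op.union}) (hn : C.noConst)
    (d : ℕ) : d ∈ C.sem I ↔ ∃ p ∈ C.paths, psem I p.1 p.2 d := by
  induction C generalizing d with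
  | bot => exact hn.elim
  | top => exact hn.elim
  | atom A => simp [ALC.sem, ALC.paths, psem]
  | neg c ih => simp [ALC.InLang] at hC
  | inter c d ih1 ih2 => simp [ALC.InLang] at hC
  | all r c ih => simp [ALC.InLang] at hC
  | union c c' ih1 ih2 =>
    simp only [ALC.sem, ALC.paths, Set.mem_union, ih1 hC.2.1 hn.1, ih2 hC.2.2 hn.2]
    constructor
    · rintro (⟨p, h, h'⟩ | ⟨p, h, h'⟩)
      · exact ⟨p, Or.inl h, h'⟩
      · exact ⟨p, Or.inr h, h'⟩
    · rintro ⟨p, h | h, h'⟩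
      · exact Or.inl ⟨p, h, h'⟩
      · exact Or.inr ⟨p, h, h'⟩
  | ex r c ih =>
    simp only [ALC.sem, ALC.paths, Set.mem_setOf_eq, ih hC.2 hn]
    constructor
    · rintro ⟨e, he, p, hp, h⟩
      exact ⟨_, ⟨p, hp, rfl⟩, e, he, h⟩
    · rintro ⟨_, ⟨p, hp, rfl⟩, e, he, h⟩
      exact ⟨e, he, p, hp, h⟩

/-- The canonical interpretation: elements are codes of words. -/
def canon (A : ℕ) : Interp where
  dom := Set.univ
  cI := fun B => {d | B = A ∧ d = Encodable.encode ([] : List ℕ)}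
  rI := fun r => {p | ∃ l : List ℕ, p = (Encodable.encode (r :: l), Encodable.encode l)}

theorem psem_canon (A : ℕ) (u : List ℕ) (B : ℕ) (l : List ℕ) :
    psem (canon A) u B (Encodable.encode l) ↔ u = l ∧ B = A := by
  induction u generalizing l with
  | nil =>
    change (B = A ∧ Encodable.encode l = Encodable.encode ([] : List ℕ)) ↔ _
    rw [Encodable.encode_inj]
    tauto
  | cons r u ih =>
    constructor
    · rintro ⟨e, ⟨l', hl⟩, h⟩
      rw [Prod.mk.injEq, Encodable.encode_inj] at hl
      obtain ⟨rfl, rfl⟩ := hl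
      obtain ⟨rfl, rfl⟩ := (ih _).1 h
      exact ⟨rfl, rfl⟩
    · rintro ⟨rfl, rfl⟩
      exact ⟨_, ⟨u, rfl⟩, (ih _).2 ⟨rfl, rfl⟩⟩

/-- For L({∃,⊔}) concepts C, D in which neither ⊤ nor ⊥ occurs,
D ⊑ C if and only if every path of D is a path of C. -/
theorem statement17 (C D : ALC)
    (hC : C.InLang {Op.ex, Op.union}) (hD : D.InLang {Op.ex, Op.union})
    (hCn : C.noConst) (hDn : D.noConst) :
    Subsume D C ↔ D.paths ⊆ C.paths := by
  constructor
  · rintro h ⟨w, A⟩ hp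
    have hwf : (canon A).WF := by
      refine ⟨⟨0, trivial⟩, fun _ _ _ => trivial, fun _ _ _ => ⟨trivial, trivial⟩⟩
    have h1 := h (canon A) hwf
      ((sem_iff (canon A) D hD hDn (Encodable.encode w)).2
        ⟨(w, A), hp, (psem_canon A w A w).2 ⟨rfl, rfl⟩⟩)
    obtain ⟨⟨u, B⟩, hq, hs⟩ := (sem_iff _ C hC hCn _).1 h1
    obtain ⟨rfl, rfl⟩ := (psem_canon _ _ _ _).1 hs
    exact hq
  · intro h I _ d hd
    obtain ⟨p, hp, hs⟩ := (sem_iff I D hD hDn d).1 hd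
    exact (sem_iff I C hC hCn d).2 ⟨p, h hp, hs⟩

end ALCPaper
end
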